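/- Let B₀ : ℝ → ℝ be a smooth function such that ∫ B₀ Q^{5/2} = 0, ∫ B₀ Q' = 0, and for 0 ≤ k ≤ 3 there are constants C_k with |B₀^{(k)}(x)| ≤ C_k e^{−(√3/2)|x|} for all x ∈ ℝ. Then ∫_ℝ L(B₀')(x) B₀(x) Q'(x)/Q²(x) dx ≥ (3/8) ∫_ℝ B₀²(x)/Q(x) dx + 7 ∫_ℝ B₀²(x) Q²(x) dx. -/

import Mathlib

open Real MeasureTheory Filter

noncomputable def Q (x : ℝ) : ℝ := (5 / (2 * Real.cosh (3 * x / 2) ^ 2)) ^ ((1:ℝ)/3)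

/-- The linearized operator `L f = −f'' + f − 4Q³ f`. -/
noncomputable def LQ (f : ℝ → ℝ) : ℝ → ℝ :=
  fun x => -iteratedDeriv 2 f x + f x - 4 * (Q x) ^ 3 * f x

/-- `f` is continuous and `|f x| ≤ C e^{-c|x|}` for some `C`. For `c = 0` this says that `f` is
continuous and bounded. -/
def ExpDecay (c : ℝ) (f : ℝ → ℝ) : Prop :=
  Continuous f ∧ ∃ C : ℝ, ∀ x, |f x| ≤ C * exp (-c * |x|)

namespace ExpDecay

variable {c : ℝ} {f g : ℝ → ℝ}

lemma add (hf : ExpDecay c f) (hg : ExpDecay c g) : ExpDecay c (fun x => f x + g x) := by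
  obtain ⟨hf, C, hC⟩ := hf
  obtain ⟨hg, D, hD⟩ := hg
  refine ⟨hf.add hg, C + D, fun x => ?_⟩
  linarith [abs_add_le (f x) (g x), hC x, hD x, add_mul C D (exp (-c * |x|))]

lemma mul (hf : ExpDecay 0 f) (hg : ExpDecay c g) : ExpDecay c (fun x => f x * g x) := by
  obtain ⟨hf, C, hC⟩ := hf
  obtain ⟨hg, D, hD⟩ := hg
  refine ⟨hf.mul hg, C * D, fun x => ?_⟩
  have hC' : |f x| ≤ C := by simpa using hC x
  rw [abs_mul, mul_assoc]
  exact mul_le_mul hC' (hD x) (abs_nonneg _) ((abs_nonneg _).trans hC')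

lemma const (a : ℝ) : ExpDecay 0 (fun _ => a) :=
  ⟨continuous_const, |a|, fun x => by simp⟩

lemma neg (hf : ExpDecay c f) : ExpDecay c (fun x => -f x) := by
  simpa using (const (-1)).mul hf

lemma sub (hf : ExpDecay c f) (hg : ExpDecay c g) : ExpDecay c (fun x => f x - g x) := by
  simpa only [sub_eq_add_neg] using hf.add hg.neg

lemma bounded (hc : 0 < c) (hf : ExpDecay c f) : ExpDecay 0 f := by
  obtain ⟨hf, C, hC⟩ := hf
  have hC0 : 0 ≤ C := by simpa using (abs_nonneg _).trans (hC 0)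
  refine ⟨hf, C, fun x => (hC x).trans (mul_le_mul_of_nonneg_left (exp_le_exp.2 ?_) hC0)⟩
  nlinarith [mul_nonneg hc.le (abs_nonneg x)]

lemma pow (hf : ExpDecay 0 f) (n : ℕ) : ExpDecay 0 (fun x => f x ^ n) := by
  induction n with
  | zero => simpa using const 1
  | succ n ih => simpa only [pow_succ] using ih.mul hf

lemma integrable_exp_neg_mul_abs (hc : 0 < c) : Integrable (fun x : ℝ => exp (-c * |x|)) := by
  rw [← integrableOn_univ, ← Set.Iic_union_Ioi (a := (0 : ℝ))]
  refine IntegrableOn.union ?_ ?_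
  · refine (integrableOn_exp_mul_Iic hc 0).congr_fun (fun x hx => ?_) measurableSet_Iic
    simp [abs_of_nonpos (Set.mem_Iic.1 hx)]
  · refine (integrableOn_exp_mul_Ioi (neg_lt_zero.2 hc) 0).congr_fun (fun x hx => ?_)
      measurableSet_Ioi
    simp [abs_of_pos (Set.mem_Ioi.1 hx)]

lemma integrable (hc : 0 < c) (hf : ExpDecay c f) : Integrable f := by
  obtain ⟨hf, C, hC⟩ := hf
  exact ((integrable_exp_neg_mul_abs hc).const_mul C).mono' hf.aestronglyMeasurable
    (ae_of_all _ hC)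

lemma tendsto_zero (hc : 0 < c) (hf : ExpDecay c f) {l : Filter ℝ}
    (hl : Tendsto (fun x : ℝ => |x|) l atTop) : Tendsto f l (nhds 0) := by
  obtain ⟨-, C, hC⟩ := hf
  have h : Tendsto (fun x : ℝ => C * exp (-c * |x|)) l (nhds (C * 0)) :=
    (tendsto_exp_atBot.comp (hl.const_mul_atTop_of_neg (neg_lt_zero.2 hc))).const_mul C
  rw [mul_zero] at h
  exact squeeze_zero_norm hC h

lemma integral_deriv_eq_zero (hc : 0 < c) (hf : ExpDecay c f) (hg : ExpDecay c g)
    (hfg : ∀ x, HasDerivAt f (g x) x) : ∫ x, g x = 0 := by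
  simpa using integral_of_hasDerivAt_of_tendsto hfg (hg.integrable hc)
    (hf.tendsto_zero hc tendsto_abs_atBot_atTop) (hf.tendsto_zero hc tendsto_abs_atTop_atTop)

end ExpDecay

lemma hasDerivAt_cosh_scaled (x : ℝ) :
    HasDerivAt (fun x : ℝ => cosh (3 * x / 2)) (3 / 2 * sinh (3 * x / 2)) x := by
  have h : HasDerivAt (fun x : ℝ => 3 * x / 2) (3 / 2) x := by
    simpa using ((hasDerivAt_id x).const_mul 3).div_const 2
  simpa [mul_comm] using h.cosh

lemma hasDerivAt_tanh_scaled (x : ℝ) :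
    HasDerivAt (fun x : ℝ => tanh (3 * x / 2)) (3 / 2 * (1 - tanh (3 * x / 2) ^ 2)) x := by
  have h : HasDerivAt (fun x : ℝ => 3 * x / 2) (3 / 2) x := by
    simpa using ((hasDerivAt_id x).const_mul 3).div_const 2
  have hc := (cosh_pos (3 * x / 2)).ne'
  simp only [tanh_eq_sinh_div_cosh]
  refine (h.sinh.div h.cosh hc).congr_deriv ?_
  field_simp

lemma one_sub_tanh_sq (x : ℝ) : 1 - tanh x ^ 2 = 1 / cosh x ^ 2 := by
  have hc := (cosh_pos x).ne'
  rw [tanh_eq_sinh_div_cosh]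
  field_simp
  linarith [cosh_sq x]

lemma expDecay_tanh : ExpDecay 0 (fun x : ℝ => tanh (3 * x / 2)) :=
  ⟨continuous_iff_continuousAt.2 fun x => (hasDerivAt_tanh_scaled x).continuousAt, 1, fun x => by
    simpa using (abs_tanh_lt_one _).le⟩

lemma expDecay_cosh_inv (n : ℕ) : ExpDecay 0 (fun x : ℝ => (cosh (3 * x / 2) ^ n)⁻¹) := by
  refine ⟨?_, 1, fun x => ?_⟩
  · exact (Continuous.pow (by fun_prop) n).inv₀ fun x => (pow_pos (cosh_pos _) n).ne'
  · have h : 1 ≤ cosh (3 * x / 2) ^ n := one_le_pow₀ (one_le_cosh _)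
    rw [abs_of_pos (inv_pos.2 (zero_lt_one.trans_le h))]
    simpa using inv_le_one_of_one_le₀ h

/-- The equation `h' - (3n/2) tanh(3x/2) h = f` has a solution with the decay of `f` as soon as
`f` is orthogonal to the solution `cosh(3x/2)^{-n}` of the adjoint equation. -/
lemma ExpDecay.exists_solution {c : ℝ} (hc : 0 < c) {f : ℝ → ℝ} (hf : ExpDecay c f) (n : ℕ)
    (horth : ∫ x, (cosh (3 * x / 2) ^ n)⁻¹ * f x = 0) :
    ∃ h : ℝ → ℝ, ExpDecay c h ∧
      ∀ x, HasDerivAt h (f x + 3 * n / 2 * tanh (3 * x / 2) * h x) x := by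
  set r : ℝ → ℝ := fun x => cosh (3 * x / 2) ^ n with hr
  set k : ℝ → ℝ := fun x => (cosh (3 * x / 2) ^ n)⁻¹ * f x with hk
  have hkdec : ExpDecay c k := (expDecay_cosh_inv n).mul hf
  have hkint : Integrable k := hkdec.integrable hc
  have hrpos : ∀ x, 0 < r x := fun x => pow_pos (cosh_pos _) n
  have hcompare : ∀ x z, |x| ≤ |z| → |r x * k z| ≤ |f z| := by
    intro x z hxz
    have hle : r x ≤ r z := by
      refine pow_le_pow_left₀ (cosh_pos _).le (cosh_le_cosh.2 ?_) n
      rw [abs_div, abs_div, abs_mul, abs_mul]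
      gcongr
    have hkz : r x * k z = r x / r z * f z := by simp only [hk, hr]; ring
    rw [hkz, abs_mul, abs_of_pos (div_pos (hrpos x) (hrpos z))]
    exact mul_le_of_le_one_left (abs_nonneg _) ((div_le_one (hrpos z)).2 hle)
  have hderiv : ∀ x, HasDerivAt (fun x => r x * ∫ z in Set.Iic x, k z)
      (f x + 3 * n / 2 * tanh (3 * x / 2) * (r x * ∫ z in Set.Iic x, k z)) x := by
    intro x
    have hprim : HasDerivAt (fun x => ∫ z in Set.Iic x, k z) (k x) x := by
      have heq : (fun x => ∫ z in Set.Iic x, k z) =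
          fun x => (∫ z in Set.Iic 0, k z) + ∫ z in (0 : ℝ)..x, k z := by
        funext y
        rw [← intervalIntegral.integral_Iic_sub_Iic hkint.integrableOn hkint.integrableOn]
        ring
      rw [heq]
      exact (hkdec.1.integral_hasStrictDerivAt 0 x).hasDerivAt.const_add _
    have hrd : HasDerivAt r (3 * n / 2 * tanh (3 * x / 2) * r x) x := by
      refine ((hasDerivAt_cosh_scaled x).pow n).congr_deriv ?_
      have hcx := (cosh_pos (3 * x / 2)).ne'
      simp only [hr, tanh_eq_sinh_div_cosh]
      cases n with
      | zero => simp
      | succ m =>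
        rw [Nat.add_sub_cancel, pow_succ]
        field_simp
    refine (hrd.mul hprim).congr_deriv ?_
    have hrk : r x * k x = f x := mul_inv_cancel_left₀ (hrpos x).ne' _
    rw [hrk]
    ring
  obtain ⟨-, C, hC⟩ := hf
  refine ⟨fun x => r x * ∫ z in Set.Iic x, k z, ⟨?_, C / c, fun x => ?_⟩, hderiv⟩
  · exact continuous_iff_continuousAt.2 fun x => (hderiv x).continuousAt
  beta_reduce
  rcases le_total x 0 with hx | hx
  · rw [← integral_const_mul, abs_of_nonpos hx]
    calc |∫ z in Set.Iic x, r x * k z| ≤ ∫ z in Set.Iic x, C * exp (c * z) := by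
          rw [← norm_eq_abs]
          refine norm_integral_le_of_norm_le
            ((integrableOn_exp_mul_Iic hc x).const_mul C)
            ((ae_restrict_iff' measurableSet_Iic).2 (ae_of_all _ fun z hz => ?_))
          have hz0 : z ≤ 0 := (Set.mem_Iic.1 hz).trans hx
          refine (hcompare x z ?_).trans ((hC z).trans_eq ?_)
          · rw [abs_of_nonpos hx, abs_of_nonpos hz0]
            exact neg_le_neg hz
          · rw [abs_of_nonpos hz0, neg_mul_neg]
      _ = C / c * exp (-c * -x) := by
          rw [integral_const_mul, integral_exp_mul_Iic hc, neg_mul_neg]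
          ring
  · have hneg : ∫ z in Set.Iic x, k z = -∫ z in Set.Ioi x, k z := by
      have h := intervalIntegral.integral_Iic_add_Ioi (b := x) hkint.integrableOn
        hkint.integrableOn
      rw [horth] at h
      linarith
    rw [hneg, mul_neg, abs_neg, ← integral_const_mul, abs_of_nonneg hx]
    calc |∫ z in Set.Ioi x, r x * k z| ≤ ∫ z in Set.Ioi x, C * exp (-c * z) := by
          rw [← norm_eq_abs]
          refine norm_integral_le_of_norm_le
            ((integrableOn_exp_mul_Ioi (neg_lt_zero.2 hc) x).const_mul C)
            ((ae_restrict_iff' measurableSet_Ioi).2 (ae_of_all _ fun z hz => ?_))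
          have hz0 : 0 ≤ z := hx.trans (Set.mem_Ioi.1 hz).le
          refine (hcompare x z ?_).trans ((hC z).trans_eq ?_)
          · rw [abs_of_nonneg hx, abs_of_nonneg hz0]
            exact (Set.mem_Ioi.1 hz).le
          · rw [abs_of_nonneg hz0]
      _ = C / c * exp (-c * x) := by
          rw [integral_const_mul, integral_exp_mul_Ioi (neg_lt_zero.2 hc)]
          field_simp

/-- The quadratic form of `-∂_y² - 6 sech² y`, `y = 3x/2`, is nonnegative on the orthogonal
complement of its bound states `sech² y` and `sech y tanh y`. -/
lemma poschlTeller_nonneg {c : ℝ} (hc : 0 < c) {u u' : ℝ → ℝ} (hu : ExpDecay c u)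
    (hu' : ExpDecay c u') (hderiv : ∀ x, HasDerivAt u (u' x) x)
    (horth₂ : ∫ x, (cosh (3 * x / 2) ^ 2)⁻¹ * u x = 0)
    (horth₁ : ∫ x, tanh (3 * x / 2) * ((cosh (3 * x / 2) ^ 1)⁻¹ * u x) = 0) :
    0 ≤ ∫ x, (4 / 9 * u' x * u' x - 6 * (1 - tanh (3 * x / 2) ^ 2) * u x * u x) := by
  obtain ⟨w, hw, hwd⟩ := hu.exists_solution hc 2 horth₂
  have hworth : ∫ x, (cosh (3 * x / 2) ^ 1)⁻¹ * w x = 0 := by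
    have hdec₁ := expDecay_tanh.mul ((expDecay_cosh_inv 1).mul hu)
    have hdec₂ := (ExpDecay.const (3 / 2)).mul ((expDecay_cosh_inv 1).mul hw)
    have h := ExpDecay.integral_deriv_eq_zero hc
      (expDecay_tanh.mul ((expDecay_cosh_inv 1).mul hw)) (hdec₁.add hdec₂) fun x => by
        have hcx := (cosh_pos (3 * x / 2)).ne'
        have hinv : HasDerivAt (fun x => (cosh (3 * x / 2) ^ 1)⁻¹)
            (-(3 / 2) * tanh (3 * x / 2) * (cosh (3 * x / 2) ^ 1)⁻¹) x := by
          simp only [pow_one]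
          refine ((hasDerivAt_cosh_scaled x).fun_inv hcx).congr_deriv ?_
          rw [tanh_eq_sinh_div_cosh]
          field_simp
        refine ((hasDerivAt_tanh_scaled x).fun_mul (hinv.fun_mul (hwd x))).congr_deriv ?_
        push_cast
        ring
    rw [integral_add (hdec₁.integrable hc) (hdec₂.integrable hc), horth₁, integral_const_mul] at h
    linarith
  obtain ⟨g, hg, hgd⟩ := hw.exists_solution hc 1 hworth
  have ht := expDecay_tanh
  have hu₀ := hu.bounded hc
  have hu'₀ := hu'.bounded hc
  have hw₀ := hw.bounded hc
  have hg₀ := hg.bounded hc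
  -- `g₁`, `g₂`, `g₃` are the first three derivatives of `g` with respect to `y = 3x/2`
  set g₁ : ℝ → ℝ := fun x => 2 / 3 * w x + tanh (3 * x / 2) * g x with hg₁_def
  set g₂ : ℝ → ℝ := fun x => 4 / 9 * u x + 2 * tanh (3 * x / 2) * w x + g x with hg₂_def
  set g₃ : ℝ → ℝ := fun x => 8 / 27 * u' x + 4 / 3 * tanh (3 * x / 2) * u x
    + (2 * tanh (3 * x / 2) ^ 2 + 8 / 3) * w x + tanh (3 * x / 2) * g x with hg₃_def
  have hform : ExpDecay c
      (fun x => 4 / 9 * u' x * u' x - 6 * (1 - tanh (3 * x / 2) ^ 2) * u x * u x) := by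
    repeat' first
      | exact ExpDecay.const _ | assumption | apply ExpDecay.sub | apply ExpDecay.add
      | apply ExpDecay.mul
  have hsq : ExpDecay c (fun x => 81 / 16 * (g₃ x * g₃ x + 5 * g₂ x * g₂ x + 4 * g₁ x * g₁ x)) := by
    simp only [hg₁_def, hg₂_def, hg₃_def]
    repeat' first
      | exact ExpDecay.const _ | assumption | apply ExpDecay.sub | apply ExpDecay.add
      | apply ExpDecay.mul
  have hbdry : ExpDecay c (fun x =>
      (-2 * tanh (3 * x / 2) * u x - (6 * tanh (3 * x / 2) ^ 2 + 8) * w x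
        - 3 * tanh (3 * x / 2) * g x) * u x
      + (-(27 / 2 * tanh (3 * x / 2) ^ 3 + 18 * tanh (3 * x / 2)) * w x
        - (27 / 2 * tanh (3 * x / 2) ^ 2 + 18) * g x) * w x
      + -(135 / 8) * tanh (3 * x / 2) * g x * g x) := by
    repeat' first
      | exact ExpDecay.const _ | assumption | apply ExpDecay.sub | apply ExpDecay.add
      | apply ExpDecay.mul | apply ExpDecay.neg
  have h := ExpDecay.integral_deriv_eq_zero hc hbdry (hform.sub hsq) fun x => by
    have htd := hasDerivAt_tanh_scaled x
    have hud := hderiv x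
    have hwd := hwd x
    have hgd := hgd x
    refine ((((((htd.const_mul (-2)).fun_mul hud).fun_sub
      ((((htd.fun_pow 2).const_mul 6).add_const 8).fun_mul hwd)).fun_sub
      ((htd.const_mul 3).fun_mul hgd)).fun_mul hud).fun_add
      ((((((htd.fun_pow 3).const_mul (27 / 2)).fun_add (htd.const_mul 18)).fun_neg.fun_mul
        hwd).fun_sub
        ((((htd.fun_pow 2).const_mul (27 / 2)).add_const 18).fun_mul hgd)).fun_mul hwd)).fun_add
      (((htd.const_mul (-(135 / 8))).fun_mul hgd).fun_mul hgd) |>.congr_deriv ?_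
    simp only [hg₁_def, hg₂_def, hg₃_def]
    push_cast
    ring
  rw [integral_sub (hform.integrable hc) (hsq.integrable hc), sub_eq_zero] at h
  rw [h]
  exact integral_nonneg fun x => by
    have := mul_self_nonneg (g₁ x)
    have := mul_self_nonneg (g₂ x)
    have := mul_self_nonneg (g₃ x)
    simp only [Pi.zero_apply]
    linarith

/-- The virial quadratic form in the weighted unknowns `b k = B^{(k)} Q^{-1/2}`. -/
lemma virial_form_nonneg {c : ℝ} (hc : 0 < c) {b : ℕ → ℝ → ℝ} (hb : ∀ k ≤ 3, ExpDecay c (b k))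
    (hderiv : ∀ k < 3, ∀ x, HasDerivAt (b k) (b (k + 1) x + tanh (3 * x / 2) / 2 * b k x) x)
    (horth₂ : ∫ x, (cosh (3 * x / 2) ^ 2)⁻¹ * b 0 x = 0)
    (horth₁ : ∫ x, tanh (3 * x / 2) * ((cosh (3 * x / 2) ^ 1)⁻¹ * b 0 x) = 0) :
    0 ≤ ∫ x, (-tanh (3 * x / 2) * b 0 x
        * (-b 3 x + b 1 x - 10 * (1 - tanh (3 * x / 2) ^ 2) * b 1 x)
      - (3 / 8 + 35 / 2 * (1 - tanh (3 * x / 2) ^ 2)) * b 0 x * b 0 x) := by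
  have ht := expDecay_tanh
  have hb0 := hb 0 (by norm_num)
  have hb1 := hb 1 (by norm_num)
  have hb2 := hb 2 (by norm_num)
  have hb3 := hb 3 (by norm_num)
  have hb0' := hb0.bounded hc
  have hb1' := hb1.bounded hc
  have hb2' := hb2.bounded hc
  set u' : ℝ → ℝ := fun x => b 1 x + 1 / 2 * tanh (3 * x / 2) * b 0 x with hu'_def
  have hu' : ExpDecay c u' := hb1.add (((ExpDecay.const _).mul ht).mul hb0)
  have hu'₀ := hu'.bounded hc
  have hgap := poschlTeller_nonneg hc hb0 hu' (fun x => (hderiv 0 (by norm_num) x).congr_deriv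
    (by simp only [hu'_def]; ring)) horth₂ horth₁
  have hform : ExpDecay c (fun x => -tanh (3 * x / 2) * b 0 x
        * (-b 3 x + b 1 x - 10 * (1 - tanh (3 * x / 2) ^ 2) * b 1 x)
      - (3 / 8 + 35 / 2 * (1 - tanh (3 * x / 2) ^ 2)) * b 0 x * b 0 x) := by
    repeat' first
      | exact ExpDecay.const _ | assumption | apply ExpDecay.sub | apply ExpDecay.add
      | apply ExpDecay.mul | apply ExpDecay.neg
  have hgapdec : ExpDecay c
      (fun x => 4 / 9 * u' x * u' x - 6 * (1 - tanh (3 * x / 2) ^ 2) * b 0 x * b 0 x) := by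
    repeat' first
      | exact ExpDecay.const _ | assumption | apply ExpDecay.sub | apply ExpDecay.add
      | apply ExpDecay.mul
  have hsq : ExpDecay c (fun x => (1 - tanh (3 * x / 2) ^ 2) *
      (27 / 16 * ((2 / 3 * u' x + 9 / 5 * tanh (3 * x / 2) * b 0 x)
          * (2 / 3 * u' x + 9 / 5 * tanh (3 * x / 2) * b 0 x))
        + (1 / 50 + 33 / 100 * (1 - tanh (3 * x / 2) ^ 2)) * (b 0 x * b 0 x))) := by
    repeat' first
      | exact ExpDecay.const _ | assumption | apply ExpDecay.sub | apply ExpDecay.add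
      | apply ExpDecay.mul
  have hbdry : ExpDecay c (fun x =>
      ((-(21 / 10) * tanh (3 * x / 2) ^ 3 + 27 / 20 * tanh (3 * x / 2)) * b 0 x
        + (1 / 2 * tanh (3 * x / 2) ^ 2 - 3 / 2) * b 1 x + tanh (3 * x / 2) * b 2 x) * b 0 x
      + -(1 / 2) * tanh (3 * x / 2) * b 1 x * b 1 x) := by
    repeat' first
      | exact ExpDecay.const _ | assumption | apply ExpDecay.sub | apply ExpDecay.add
      | apply ExpDecay.mul
  have h := ExpDecay.integral_deriv_eq_zero hc hbdry
    ((hform.sub ((ExpDecay.const (27 / 8)).mul hgapdec)).sub hsq) fun x => by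
    have htd := hasDerivAt_tanh_scaled x
    have hd0 := hderiv 0 (by norm_num) x
    have hd1 := hderiv 1 (by norm_num) x
    have hd2 := hderiv 2 (by norm_num) x
    refine ((((((htd.fun_pow 3).const_mul (-(21 / 10))).fun_add
        (htd.const_mul (27 / 20))).fun_mul hd0).fun_add
      ((((htd.fun_pow 2).const_mul (1 / 2)).sub_const (3 / 2)).fun_mul hd1)).fun_add
      (htd.fun_mul hd2)).fun_mul hd0 |>.fun_add
      (((htd.const_mul (-(1 / 2))).fun_mul hd1).fun_mul hd1) |>.congr_deriv ?_
    simp only [hu'_def]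
    push_cast
    ring
  rw [integral_sub ((hform.sub ((ExpDecay.const (27 / 8)).mul hgapdec)).integrable hc)
      (hsq.integrable hc),
    integral_sub (hform.integrable hc) (((ExpDecay.const (27 / 8)).mul hgapdec).integrable hc),
    integral_const_mul] at h
  have hsq_nonneg : 0 ≤ ∫ x, (1 - tanh (3 * x / 2) ^ 2) *
      (27 / 16 * ((2 / 3 * u' x + 9 / 5 * tanh (3 * x / 2) * b 0 x)
          * (2 / 3 * u' x + 9 / 5 * tanh (3 * x / 2) * b 0 x))
        + (1 / 50 + 33 / 100 * (1 - tanh (3 * x / 2) ^ 2)) * (b 0 x * b 0 x)) :=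
    integral_nonneg fun x => by
      have hS : 0 ≤ 1 - tanh (3 * x / 2) ^ 2 := by linarith [tanh_sq_lt_one (3 * x / 2)]
      have h₁ := mul_self_nonneg (2 / 3 * u' x + 9 / 5 * tanh (3 * x / 2) * b 0 x)
      have h₂ := mul_self_nonneg (b 0 x)
      simp only [Pi.zero_apply]
      positivity
  linarith

lemma Q_pos (x : ℝ) : 0 < Q x := by
  have := cosh_pos (3 * x / 2)
  unfold Q
  positivity

lemma Q_cube (x : ℝ) : Q x ^ 3 = 5 / 2 * (1 - tanh (3 * x / 2) ^ 2) := by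
  have hc := cosh_pos (3 * x / 2)
  have h : (0 : ℝ) ≤ 5 / (2 * cosh (3 * x / 2) ^ 2) := by positivity
  rw [Q, ← rpow_natCast, ← rpow_mul h, one_sub_tanh_sq]
  norm_num
  field_simp

lemma hasDerivAt_Q (x : ℝ) : HasDerivAt Q (-tanh (3 * x / 2) * Q x) x := by
  have hpos : ∀ y : ℝ, 0 < 5 / 2 * (1 - tanh (3 * y / 2) ^ 2) := fun y => by
    linarith [tanh_sq_lt_one (3 * y / 2)]
  have hQ : Q = fun y => (5 / 2 * (1 - tanh (3 * y / 2) ^ 2)) ^ ((1 : ℝ) / 3) := by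
    funext y
    rw [← Q_cube, ← rpow_natCast, ← rpow_mul (Q_pos y).le]
    norm_num
  have hbase : HasDerivAt (fun y => 5 / 2 * (1 - tanh (3 * y / 2) ^ 2))
      (-3 * tanh (3 * x / 2) * (5 / 2 * (1 - tanh (3 * x / 2) ^ 2))) x := by
    refine ((((hasDerivAt_tanh_scaled x).fun_pow 2).const_sub 1).const_mul (5 / 2)).congr_deriv ?_
    push_cast
    ring
  rw [hQ]
  refine (hbase.rpow_const (Or.inl (hpos x).ne')).congr_deriv ?_
  have hpos := (hpos x).ne'
  rw [rpow_sub_one hpos]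
  beta_reduce
  generalize 5 / 2 * (1 - tanh (3 * x / 2) ^ 2) = y at hpos ⊢
  field_simp

/-- The weight `Q^{-1/2}`. -/
noncomputable def invSqrtQ (x : ℝ) : ℝ := (√(Q x))⁻¹

lemma invSqrtQ_pos (x : ℝ) : 0 < invSqrtQ x := inv_pos.2 (sqrt_pos.2 (Q_pos x))

lemma invSqrtQ_sq (x : ℝ) : invSqrtQ x ^ 2 = (Q x)⁻¹ := by
  rw [invSqrtQ, inv_pow, sq_sqrt (Q_pos x).le]

lemma hasDerivAt_invSqrtQ (x : ℝ) :
    HasDerivAt invSqrtQ (tanh (3 * x / 2) / 2 * invSqrtQ x) x := by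
  have hs := (sqrt_pos.2 (Q_pos x)).ne'
  refine (((hasDerivAt_Q x).sqrt (Q_pos x).ne').fun_inv hs).congr_deriv ?_
  have hQ : Q x = √(Q x) ^ 2 := (sq_sqrt (Q_pos x).le).symm
  rw [invSqrtQ]
  field_simp
  linear_combination tanh (3 * x / 2) * hQ

lemma invSqrtQ_le (x : ℝ) : invSqrtQ x ≤ exp (1 / 2 * |x|) := by
  refine le_of_pow_le_pow_left₀ (n := 6) (by norm_num) (exp_pos _).le ?_
  have hc := cosh_pos (3 * x / 2)
  have hcosh : cosh (3 * x / 2) ≤ exp (3 / 2 * |x|) := by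
    have habs : |3 * x / 2| = 3 / 2 * |x| := by
      rw [abs_div, abs_mul]
      norm_num
      ring
    rw [← cosh_abs, habs, cosh_eq]
    have : exp (-(3 / 2 * |x|)) ≤ exp (3 / 2 * |x|) :=
      exp_le_exp.2 (by linarith [abs_nonneg x])
    linarith
  calc invSqrtQ x ^ 6 = 2 / 5 * cosh (3 * x / 2) ^ 2 := by
        rw [show 6 = 2 * 3 from rfl, pow_mul, invSqrtQ_sq, inv_pow, Q_cube, one_sub_tanh_sq]
        field_simp
    _ ≤ 1 * exp (3 / 2 * |x|) ^ 2 := by gcongr; norm_num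
    _ = exp (1 / 2 * |x|) ^ 6 := by
        rw [one_mul, ← exp_nat_mul, ← exp_nat_mul]
        congr 1
        push_cast
        ring

lemma expDecay_invSqrtQ_mul {a : ℝ} {f : ℝ → ℝ} (hf : Continuous f) {C : ℝ}
    (hC : ∀ x, |f x| ≤ C * exp (-a * |x|)) :
    ExpDecay (a - 1 / 2) (fun x => invSqrtQ x * f x) := by
  refine ⟨?_, C, fun x => ?_⟩
  · exact (continuous_iff_continuousAt.2 fun x => (hasDerivAt_invSqrtQ x).continuousAt).mul hf
  rw [abs_mul, abs_of_pos (invSqrtQ_pos x)]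
  calc invSqrtQ x * |f x| ≤ exp (1 / 2 * |x|) * (C * exp (-a * |x|)) :=
        mul_le_mul (invSqrtQ_le x) (hC x) (abs_nonneg _) (exp_pos _).le
    _ = C * (exp (1 / 2 * |x|) * exp (-a * |x|)) := by ring
    _ = C * exp (-(a - 1 / 2) * |x|) := by
        rw [← exp_add]
        congr 2
        ring

lemma Q_rpow_five_halves (x : ℝ) :
    Q x ^ ((5 : ℝ) / 2) = 5 / 2 * ((cosh (3 * x / 2) ^ 2)⁻¹ * invSqrtQ x) := by
  have h : Q x ^ ((5 : ℝ) / 2) = Q x ^ 3 * invSqrtQ x := by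
    rw [invSqrtQ, sqrt_eq_rpow, ← rpow_neg (Q_pos x).le, ← rpow_natCast, ← rpow_add (Q_pos x)]
    norm_num
  rw [h, Q_cube, one_sub_tanh_sq]
  ring

lemma Q_eq_mul_invSqrtQ (x : ℝ) :
    Q x = √(5 / 2) * ((cosh (3 * x / 2) ^ 1)⁻¹ * invSqrtQ x) := by
  have hc := cosh_pos (3 * x / 2)
  have hs := sqrt_pos.2 (Q_pos x)
  have hsq : √(Q x) ^ 2 = Q x := sq_sqrt (Q_pos x).le
  have h : √(Q x) ^ 3 = √(5 / 2) * (cosh (3 * x / 2))⁻¹ := by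
    refine (pow_left_inj₀ (by positivity) (by positivity) two_ne_zero).1 ?_
    rw [← pow_mul, mul_comm 3 2, pow_mul, hsq, Q_cube, one_sub_tanh_sq, mul_pow,
      sq_sqrt (by norm_num)]
    ring
  rw [pow_one, ← mul_assoc, ← h, invSqrtQ]
  field_simp
  exact hsq.symm

/-- Virial-type coercivity: if `B₀` is smooth, decays like
`e^{−(√3/2)|x|}` together with its first three derivatives, and is orthogonal to
`Q^{5/2}` and `Q'`, then
`∫ L(B₀') B₀ Q'/Q² ≥ (3/8) ∫ B₀²/Q + 7 ∫ B₀² Q²`. -/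
theorem virial_coercivity
    (B₀ : ℝ → ℝ) (hB₀ : ContDiff ℝ (⊤ : ℕ∞) B₀)
    (horth1 : (∫ x : ℝ, B₀ x * Q x ^ ((5:ℝ)/2)) = 0)
    (horth2 : (∫ x : ℝ, B₀ x * deriv Q x) = 0)
    (hdecay : ∀ k : ℕ, k ≤ 3 → ∃ C : ℝ, 0 < C ∧
      ∀ x : ℝ, |iteratedDeriv k B₀ x| ≤ C * Real.exp (-(Real.sqrt 3 / 2) * |x|)) :
    (3 / 8) * (∫ x : ℝ, (B₀ x) ^ 2 / Q x) + 7 * (∫ x : ℝ, (B₀ x) ^ 2 * (Q x) ^ 2)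
      ≤ ∫ x : ℝ, LQ (deriv B₀) x * B₀ x * deriv Q x / (Q x) ^ 2 := by
  set c : ℝ := √3 / 2 - 1 / 2 with hc_def
  have hc : 0 < c := by
    have : 1 < √3 := by
      rw [lt_sqrt] <;> norm_num
    rw [hc_def]
    linarith
  set b : ℕ → ℝ → ℝ := fun k x => invSqrtQ x * iteratedDeriv k B₀ x with hb_def
  have hb : ∀ k ≤ 3, ExpDecay c (b k) := by
    intro k hk
    obtain ⟨C, -, hC⟩ := hdecay k hk
    exact expDecay_invSqrtQ_mul (hB₀.continuous_iteratedDeriv k (mod_cast le_top)) hC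
  have hderiv : ∀ k < 3, ∀ x,
      HasDerivAt (b k) (b (k + 1) x + tanh (3 * x / 2) / 2 * b k x) x := by
    intro k _ x
    have hdiff : DifferentiableAt ℝ (iteratedDeriv k B₀) x :=
      hB₀.differentiable_iteratedDeriv k (mod_cast WithTop.coe_lt_top _) x
    have hd : HasDerivAt (iteratedDeriv k B₀) (iteratedDeriv (k + 1) B₀ x) x := by
      rw [iteratedDeriv_succ]
      exact hdiff.hasDerivAt
    refine ((hasDerivAt_invSqrtQ x).fun_mul hd).congr_deriv ?_
    simp only [hb_def]
    ring
  have horth₂ : ∫ x, (cosh (3 * x / 2) ^ 2)⁻¹ * b 0 x = 0 := by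
    have heq : ∀ x, B₀ x * Q x ^ ((5 : ℝ) / 2) = 5 / 2 * ((cosh (3 * x / 2) ^ 2)⁻¹ * b 0 x) := by
      intro x
      simp only [hb_def, iteratedDeriv_zero, Q_rpow_five_halves]
      ring
    simp only [heq, integral_const_mul] at horth1
    linarith
  have horth₁ : ∫ x, tanh (3 * x / 2) * ((cosh (3 * x / 2) ^ 1)⁻¹ * b 0 x) = 0 := by
    have heq : ∀ x, B₀ x * deriv Q x =
        -√(5 / 2) * (tanh (3 * x / 2) * ((cosh (3 * x / 2) ^ 1)⁻¹ * b 0 x)) := by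
      intro x
      rw [(hasDerivAt_Q x).deriv, Q_eq_mul_invSqrtQ]
      simp only [hb_def, iteratedDeriv_zero]
      ring
    simp only [heq, integral_const_mul] at horth2
    exact (mul_eq_zero.1 horth2).resolve_left (neg_ne_zero.2 (sqrt_pos.2 (by norm_num)).ne')
  have hmain := virial_form_nonneg hc hb hderiv horth₂ horth₁
  have hmass : ∀ x, B₀ x ^ 2 / Q x = b 0 x * b 0 x := by
    intro x
    simp only [hb_def, iteratedDeriv_zero]
    linear_combination -B₀ x ^ 2 * invSqrtQ_sq x
  have hlocal : ∀ x, B₀ x ^ 2 * Q x ^ 2 =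
      5 / 2 * (1 - tanh (3 * x / 2) ^ 2) * b 0 x * b 0 x := by
    intro x
    have hQ : Q x ^ 2 = Q x ^ 3 * invSqrtQ x ^ 2 := by
      have := (Q_pos x).ne'
      rw [invSqrtQ_sq]
      field_simp
    rw [hQ, Q_cube]
    simp only [hb_def, iteratedDeriv_zero]
    ring
  have hvirial : ∀ x, LQ (deriv B₀) x * B₀ x * deriv Q x / Q x ^ 2 =
      -tanh (3 * x / 2) * b 0 x
        * (-b 3 x + b 1 x - 10 * (1 - tanh (3 * x / 2) ^ 2) * b 1 x) := by
    intro x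
    have hQ : deriv Q x / Q x ^ 2 = -tanh (3 * x / 2) * invSqrtQ x ^ 2 := by
      have := (Q_pos x).ne'
      rw [(hasDerivAt_Q x).deriv, invSqrtQ_sq]
      field_simp
    rw [mul_div_assoc, hQ, LQ, Q_cube, ← iteratedDeriv_succ']
    simp only [hb_def, iteratedDeriv_zero, iteratedDeriv_one]
    ring
  have ht := expDecay_tanh
  have hb0 := hb 0 (by norm_num)
  have hb1 := hb 1 (by norm_num)
  have hb3 := hb 3 (by norm_num)
  have hb0' := hb0.bounded hc
  have hmass_dec : ExpDecay c (fun x => b 0 x * b 0 x) := hb0'.mul hb0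
  have hlocal_dec : ExpDecay c (fun x => 5 / 2 * (1 - tanh (3 * x / 2) ^ 2) * b 0 x * b 0 x) :=
    ((((ExpDecay.const _).mul ((ExpDecay.const 1).sub (ht.pow 2))).mul hb0').mul hb0)
  have hvirial_dec : ExpDecay c (fun x => -tanh (3 * x / 2) * b 0 x
      * (-b 3 x + b 1 x - 10 * (1 - tanh (3 * x / 2) ^ 2) * b 1 x)) :=
    (ht.neg.mul hb0').mul ((hb3.neg.add hb1).sub
      (((ExpDecay.const _).mul ((ExpDecay.const 1).sub (ht.pow 2))).mul hb1))
  have hsum := (((ExpDecay.const (3 / 8)).mul hmass_dec).add ((ExpDecay.const 7).mul hlocal_dec))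
  simp only [hmass, hlocal, hvirial]
  rw [← integral_const_mul, ← integral_const_mul,
    ← integral_add (((ExpDecay.const (3 / 8)).mul hmass_dec).integrable hc)
      (((ExpDecay.const 7).mul hlocal_dec).integrable hc),
    ← sub_nonneg, ← integral_sub (hvirial_dec.integrable hc) (hsum.integrable hc)]
  refine hmain.trans_eq (integral_congr_ae (ae_of_all _ fun x => ?_))
  ring
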